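/- On Σ = {u+iv : u > 0}, let g(u+iv) = (-1 + i·cosh(2u)·sinh(2v))/(sinh(2u) + cosh(2u)·cosh(2v)), F(u+iv) = 2·sinh v·cosh v·coth u + i·coth u - 2iu, and h(u+iv) = sinh v·cosh v·(2u·coth u - 1). Then F_z = -(i·cosh(2u) + sinh(2v) + i·cosh(2v)·sinh(2u))/(cosh(2u)-1), F_{z̄} = -(i·cosh(2u) + sinh(2v) - i·cosh(2v)·sinh(2u))/(cosh(2u)-1), and F_z = -4i·g_z/(1-|g|²)², F_{z̄} = -4i·g²·conj(g_z)/(1-|g|²)². -/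

import Mathlib

open Complex
open ComplexConjugate

/-- Wirtinger derivative `∂_z = (∂_u - i ∂_v)/2` of a map `ℂ → ℂ`. -/
noncomputable def Wz (f : ℂ → ℂ) (p : ℂ) : ℂ :=
  (1/2) * (fderiv ℝ f p 1 - I * fderiv ℝ f p I)

/-- Wirtinger derivative `∂_z̄ = (∂_u + i ∂_v)/2` of a map `ℂ → ℂ`. -/
noncomputable def Wzb (f : ℂ → ℂ) (p : ℂ) : ℂ :=
  (1/2) * (fderiv ℝ f p 1 + I * fderiv ℝ f p I)

/-- Wirtinger derivative `∂_z` of a real-valued function on `ℂ`. -/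
noncomputable def WzR (h : ℂ → ℝ) (p : ℂ) : ℂ :=
  (1/2) * ((fderiv ℝ h p 1 : ℝ) - I * (fderiv ℝ h p I : ℝ))

/-- `1 - |w|²` as a complex number. -/
noncomputable def NS (w : ℂ) : ℂ := ((1 - Complex.normSq w : ℝ) : ℂ)

/-- `η = 8i·conj(g)·g_z/(1-|g|²)²`. -/
noncomputable def Eta (g : ℂ → ℂ) (z : ℂ) : ℂ :=
  8 * I * conj (g z) * Wz g z / (NS (g z))^2

/-- Gauss map of the semitrough example. -/
noncomputable def gS (z : ℂ) : ℂ :=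
  (-1 + I * (Real.cosh (2*z.re) : ℂ) * (Real.sinh (2*z.im) : ℂ))
    / ((Real.sinh (2*z.re) : ℂ) + (Real.cosh (2*z.re) : ℂ) * (Real.cosh (2*z.im) : ℂ))

/-- Horizontal projection of the entire minimal graph built from the semitrough. -/
noncomputable def FS (z : ℂ) : ℂ :=
  ((2 * Real.sinh z.im * Real.cosh z.im * (Real.cosh z.re / Real.sinh z.re) : ℝ) : ℂ)
    + I * ((Real.cosh z.re / Real.sinh z.re : ℝ) : ℂ) - 2 * I * (z.re : ℂ)

/-- Height function of the entire minimal graph built from the semitrough. -/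
noncomputable def hS (z : ℂ) : ℝ :=
  Real.sinh z.im * Real.cosh z.im * (2 * z.re * (Real.cosh z.re / Real.sinh z.re) - 1)

/-- Both partial derivatives of `f` at `z`, packaged with real differentiability. -/
def HasPartials (f : ℂ → ℂ) (a b z : ℂ) : Prop :=
  DifferentiableAt ℝ f z ∧ fderiv ℝ f z 1 = a ∧ fderiv ℝ f z I = b

lemma HasPartials.Wz_eq {f : ℂ → ℂ} {a b z : ℂ} (h : HasPartials f a b z) :
    Wz f z = (1/2) * (a - I * b) := by
  rw [Wz, h.2.1, h.2.2]

lemma HasPartials.Wzb_eq {f : ℂ → ℂ} {a b z : ℂ} (h : HasPartials f a b z) :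
    Wzb f z = (1/2) * (a + I * b) := by
  rw [Wzb, h.2.1, h.2.2]

lemma HasPartials.of_re {φ : ℝ → ℝ} {d : ℝ} {z : ℂ} (h : HasDerivAt φ d z.re) :
    HasPartials (fun w => (φ w.re : ℂ)) d 0 z := by
  have h₁ := ofRealCLM.hasFDerivAt.comp z (h.hasFDerivAt.comp z reCLM.hasFDerivAt)
  refine ⟨h₁.differentiableAt, ?_, ?_⟩
  · exact (congrArg (fun L : ℂ →L[ℝ] ℂ => L 1) h₁.fderiv).trans (by simp)
  · exact (congrArg (fun L : ℂ →L[ℝ] ℂ => L I) h₁.fderiv).trans (by simp)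

lemma HasPartials.of_im {φ : ℝ → ℝ} {d : ℝ} {z : ℂ} (h : HasDerivAt φ d z.im) :
    HasPartials (fun w => (φ w.im : ℂ)) 0 d z := by
  have h₁ := ofRealCLM.hasFDerivAt.comp z (h.hasFDerivAt.comp z imCLM.hasFDerivAt)
  refine ⟨h₁.differentiableAt, ?_, ?_⟩
  · exact (congrArg (fun L : ℂ →L[ℝ] ℂ => L 1) h₁.fderiv).trans (by simp)
  · exact (congrArg (fun L : ℂ →L[ℝ] ℂ => L I) h₁.fderiv).trans (by simp)

lemma HasPartials.const (c z : ℂ) : HasPartials (fun _ => c) 0 0 z :=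
  ⟨differentiableAt_const c, by simp, by simp⟩

lemma HasPartials.add {f g : ℂ → ℂ} {a b c d z : ℂ} (hf : HasPartials f a b z)
    (hg : HasPartials g c d z) : HasPartials (fun w => f w + g w) (a + c) (b + d) z := by
  obtain ⟨hf, rfl, rfl⟩ := hf
  obtain ⟨hg, rfl, rfl⟩ := hg
  exact ⟨hf.add hg, by simp [fderiv_fun_add hf hg], by simp [fderiv_fun_add hf hg]⟩

lemma HasPartials.mul {f g : ℂ → ℂ} {a b c d z : ℂ} (hf : HasPartials f a b z)
    (hg : HasPartials g c d z) :
    HasPartials (fun w => f w * g w) (f z * c + g z * a) (f z * d + g z * b) z := by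
  obtain ⟨hf, rfl, rfl⟩ := hf
  obtain ⟨hg, rfl, rfl⟩ := hg
  exact ⟨hf.mul hg, by simp [fderiv_fun_mul hf hg], by simp [fderiv_fun_mul hf hg]⟩

lemma HasPartials.div {f g : ℂ → ℂ} {a b c d z : ℂ} (hf : HasPartials f a b z)
    (hg : HasPartials g c d z) (h0 : g z ≠ 0) :
    HasPartials (fun w => f w / g w) ((a * g z - f z * c) / g z ^ 2)
      ((b * g z - f z * d) / g z ^ 2) z := by
  obtain ⟨hf, rfl, rfl⟩ := hf
  obtain ⟨hg, rfl, rfl⟩ := hg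
  have hq : DifferentiableAt ℝ (fun w => f w / g w) z := by
    have hi : DifferentiableAt ℝ (fun w => (g w)⁻¹) z :=
      DifferentiableAt.comp z ((differentiableAt_inv (𝕜 := ℂ) h0).restrictScalars ℝ) hg
    simpa only [div_eq_mul_inv] using hf.fun_mul hi
  have hm : fderiv ℝ f z = fderiv ℝ (fun w => f w / g w * g w) z := by
    refine Filter.EventuallyEq.fderiv_eq ?_
    filter_upwards [hg.continuousAt.eventually_ne h0] with w hw
    rw [div_mul_cancel₀ _ hw]
  have key (v : ℂ) : fderiv ℝ (fun w => f w / g w) z v =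
      (fderiv ℝ f z v * g z - f z * fderiv ℝ g z v) / g z ^ 2 := by
    rw [hm, fderiv_fun_mul hq hg]
    simp only [add_apply, smul_apply, smul_eq_mul]
    field_simp
    ring
  exact ⟨hq, key 1, key I⟩

lemma hasDerivAt_cosh_two_mul (x : ℝ) :
    HasDerivAt (fun t => Real.cosh (2 * t)) (2 * Real.sinh (2 * x)) x := by
  simpa [mul_comm] using ((hasDerivAt_id x).const_mul 2).cosh

lemma hasDerivAt_sinh_two_mul (x : ℝ) :
    HasDerivAt (fun t => Real.sinh (2 * t)) (2 * Real.cosh (2 * x)) x := by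
  simpa [mul_comm] using ((hasDerivAt_id x).const_mul 2).sinh

lemma hasDerivAt_coth {x : ℝ} (hx : Real.sinh x ≠ 0) :
    HasDerivAt (fun t => Real.cosh t / Real.sinh t) (-1 / Real.sinh x ^ 2) x := by
  refine ((Real.hasDerivAt_cosh x).fun_div (Real.hasDerivAt_sinh x) hx).congr_deriv ?_
  congr 1
  linear_combination -Real.cosh_sq_sub_sinh_sq x

lemma FS_eq (z : ℂ) : FS z = (Real.sinh (2 * z.im) : ℂ) *
    ((Real.cosh z.re / Real.sinh z.re : ℝ) : ℂ)
    + I * ((Real.cosh z.re / Real.sinh z.re : ℝ) : ℂ) + (-2 * I) * (z.re : ℂ) := by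
  rw [FS, Real.sinh_two_mul]
  push_cast
  ring

lemma hasPartials_FS {z : ℂ} (hz : Real.sinh z.re ≠ 0) :
    HasPartials FS
      (-((Real.sinh (2 * z.im) : ℂ) + I) / (Real.sinh z.re : ℂ) ^ 2 - 2 * I)
      (2 * (Real.cosh (2 * z.im) : ℂ) * (Real.cosh z.re : ℂ) / (Real.sinh z.re : ℂ)) z := by
  have hcoth := HasPartials.of_re (hasDerivAt_coth hz)
  have h := (((HasPartials.of_im (hasDerivAt_sinh_two_mul z.im)).mul hcoth).add
    ((HasPartials.const I z).mul hcoth)).add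
      ((HasPartials.const (-2 * I) z).mul (HasPartials.of_re (hasDerivAt_id' z.re)))
  rw [funext FS_eq]
  convert h using 1
  · push_cast
    ring
  · push_cast
    ring

lemma semitrough_denom_pos {u : ℝ} (hu : 0 < u) (v : ℝ) :
    0 < Real.sinh (2 * u) + Real.cosh (2 * u) * Real.cosh (2 * v) := by
  have := Real.sinh_pos_iff.2 (show 0 < 2 * u by linarith)
  have := Real.cosh_pos (2 * u)
  have := Real.cosh_pos (2 * v)
  positivity

lemma Wz_gS {z : ℂ} (hz : 0 < z.re) :
    Wz gS z = (1 + (Real.cosh (2 * z.re) : ℂ)) * ((Real.cosh (2 * z.re) : ℂ) +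
      (Real.sinh (2 * z.re) : ℂ) * (Real.cosh (2 * z.im) : ℂ) - I * (Real.sinh (2 * z.im) : ℂ)) /
      ((Real.sinh (2 * z.re) : ℂ) + (Real.cosh (2 * z.re) : ℂ) * (Real.cosh (2 * z.im) : ℂ)) ^ 2 := by
  have hD : (Real.sinh (2 * z.re) : ℂ) +
      (Real.cosh (2 * z.re) : ℂ) * (Real.cosh (2 * z.im) : ℂ) ≠ 0 := by
    exact_mod_cast (semitrough_denom_pos hz z.im).ne'
  have hA := HasPartials.of_re (hasDerivAt_cosh_two_mul z.re)
  have hB := HasPartials.of_re (hasDerivAt_sinh_two_mul z.re)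
  have hC := HasPartials.of_im (hasDerivAt_cosh_two_mul z.im)
  have hS := HasPartials.of_im (hasDerivAt_sinh_two_mul z.im)
  have h : HasPartials gS _ _ z := ((HasPartials.const (-1) z).add
    (((HasPartials.const I z).mul hA).mul hS)).div (hB.add (hA.mul hC)) hD
  have e₁ : (Real.cosh (2 * z.re) : ℂ) ^ 2 - (Real.sinh (2 * z.re) : ℂ) ^ 2 = 1 := by
    exact_mod_cast Real.cosh_sq_sub_sinh_sq (2 * z.re)
  have e₂ : (Real.cosh (2 * z.im) : ℂ) ^ 2 - (Real.sinh (2 * z.im) : ℂ) ^ 2 = 1 := by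
    exact_mod_cast Real.cosh_sq_sub_sinh_sq (2 * z.im)
  rw [h.Wz_eq]
  push_cast only [ofReal_mul, ofReal_ofNat]
  generalize (Real.cosh (2 * z.re) : ℂ) = A at *
  generalize (Real.sinh (2 * z.re) : ℂ) = B at *
  generalize (Real.cosh (2 * z.im) : ℂ) = C at *
  generalize (Real.sinh (2 * z.im) : ℂ) = S at *
  field_simp
  linear_combination (-2 * I * S) * e₁ + 2 * A ^ 2 * e₂ -
    2 * (A * B * C + A ^ 2 * C ^ 2 - A ^ 2 * S ^ 2) * I_sq

lemma NS_gS {z : ℂ} (hz : 0 < z.re) :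
    NS (gS z) = 2 * (Real.sinh (2 * z.re) : ℂ) /
      ((Real.sinh (2 * z.re) : ℂ) + (Real.cosh (2 * z.re) : ℂ) * (Real.cosh (2 * z.im) : ℂ)) := by
  have hD := (semitrough_denom_pos hz z.im).ne'
  have e₁ := Real.cosh_sq_sub_sinh_sq (2 * z.re)
  have e₂ := Real.cosh_sq_sub_sinh_sq (2 * z.im)
  have hn : normSq (-1 + I * (Real.cosh (2 * z.re) : ℂ) * (Real.sinh (2 * z.im) : ℂ)) =
      1 + (Real.cosh (2 * z.re) * Real.sinh (2 * z.im)) ^ 2 := by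
    rw [show -1 + I * (Real.cosh (2 * z.re) : ℂ) * (Real.sinh (2 * z.im) : ℂ) =
      ((-1 : ℝ) : ℂ) + ((Real.cosh (2 * z.re) * Real.sinh (2 * z.im) : ℝ) : ℂ) * I by
        push_cast; ring, normSq_add_mul_I]
    ring
  have hd : normSq ((Real.sinh (2 * z.re) : ℂ) +
      (Real.cosh (2 * z.re) : ℂ) * (Real.cosh (2 * z.im) : ℂ)) =
      (Real.sinh (2 * z.re) + Real.cosh (2 * z.re) * Real.cosh (2 * z.im)) ^ 2 := by
    rw [← ofReal_mul, ← ofReal_add, normSq_ofReal, sq]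
  rw [NS, gS, map_div₀, hn, hd]
  norm_cast
  field_simp
  linear_combination Real.cosh (2 * z.re) ^ 2 * e₂ + e₁

theorem stmt13 : ∀ z : ℂ, 0 < z.re →
    Wz FS z = -(I * (Real.cosh (2*z.re) : ℂ) + (Real.sinh (2*z.im) : ℂ)
        + I * (Real.cosh (2*z.im) : ℂ) * (Real.sinh (2*z.re) : ℂ))
        / ((Real.cosh (2*z.re) : ℂ) - 1) ∧
    Wzb FS z = -(I * (Real.cosh (2*z.re) : ℂ) + (Real.sinh (2*z.im) : ℂ)
        - I * (Real.cosh (2*z.im) : ℂ) * (Real.sinh (2*z.re) : ℂ))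
        / ((Real.cosh (2*z.re) : ℂ) - 1) ∧
    Wz FS z = -4 * I * Wz gS z / (NS (gS z))^2 ∧
    Wzb FS z = -4 * I * (gS z)^2 * conj (Wz gS z) / (NS (gS z))^2 := by
  intro z hz
  have hs := Real.sinh_pos_iff.2 hz
  have hs' : (Real.sinh z.re : ℂ) ≠ 0 := by exact_mod_cast hs.ne'
  have hB : (Real.sinh (2 * z.re) : ℂ) ≠ 0 := by
    exact_mod_cast (Real.sinh_pos_iff.2 (show 0 < 2 * z.re by linarith)).ne'
  have hD : (Real.sinh (2 * z.re) : ℂ) +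
      (Real.cosh (2 * z.re) : ℂ) * (Real.cosh (2 * z.im) : ℂ) ≠ 0 := by
    exact_mod_cast (semitrough_denom_pos hz z.im).ne'
  have c₂ : (Real.cosh (2 * z.re) : ℂ) = 1 + 2 * (Real.sinh z.re : ℂ) ^ 2 := by
    have h : Real.cosh (2 * z.re) = 1 + 2 * Real.sinh z.re ^ 2 := by
      rw [Real.cosh_two_mul, Real.cosh_sq]; ring
    exact_mod_cast h
  have s₂ : (Real.sinh (2 * z.re) : ℂ) = 2 * (Real.sinh z.re : ℂ) * (Real.cosh z.re : ℂ) := by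
    exact_mod_cast Real.sinh_two_mul z.re
  have hA1 : (Real.cosh (2 * z.re) : ℂ) - 1 ≠ 0 := by
    rw [c₂, add_sub_cancel_left]; exact mul_ne_zero two_ne_zero (pow_ne_zero 2 hs')
  have e₁ : (Real.cosh (2 * z.re) : ℂ) ^ 2 - (Real.sinh (2 * z.re) : ℂ) ^ 2 = 1 := by
    exact_mod_cast Real.cosh_sq_sub_sinh_sq (2 * z.re)
  have e₂ : (Real.cosh (2 * z.im) : ℂ) ^ 2 - (Real.sinh (2 * z.im) : ℂ) ^ 2 = 1 := by
    exact_mod_cast Real.cosh_sq_sub_sinh_sq (2 * z.im)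
  have hF := hasPartials_FS hs.ne'
  have h₁ : Wz FS z = -(I * (Real.cosh (2*z.re) : ℂ) + (Real.sinh (2*z.im) : ℂ)
        + I * (Real.cosh (2*z.im) : ℂ) * (Real.sinh (2*z.re) : ℂ))
        / ((Real.cosh (2*z.re) : ℂ) - 1) := by
    rw [hF.Wz_eq, c₂, s₂, add_sub_cancel_left]
    field_simp
    ring
  have h₂ : Wzb FS z = -(I * (Real.cosh (2*z.re) : ℂ) + (Real.sinh (2*z.im) : ℂ)
        - I * (Real.cosh (2*z.im) : ℂ) * (Real.sinh (2*z.re) : ℂ))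
        / ((Real.cosh (2*z.re) : ℂ) - 1) := by
    rw [hF.Wzb_eq, c₂, s₂, add_sub_cancel_left]
    field_simp
    ring
  refine ⟨h₁, h₂, ?_, ?_⟩
  · rw [h₁, Wz_gS hz, NS_gS hz]
    generalize (Real.cosh (2 * z.re) : ℂ) = A at *
    generalize (Real.sinh (2 * z.re) : ℂ) = B at *
    generalize (Real.cosh (2 * z.im) : ℂ) = C at *
    generalize (Real.sinh (2 * z.im) : ℂ) = S at *
    field_simp
    linear_combination 4 * (I * A + S + I * C * B) * e₁ - 4 * (A ^ 2 - 1) * S * I_sq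
  · rw [h₂, Wz_gS hz, NS_gS hz, gS]
    simp only [map_div₀, map_mul, map_add, map_sub, map_pow, map_one, conj_ofReal, conj_I]
    generalize (Real.cosh (2 * z.re) : ℂ) = A at *
    generalize (Real.sinh (2 * z.re) : ℂ) = B at *
    generalize (Real.cosh (2 * z.im) : ℂ) = C at *
    generalize (Real.sinh (2 * z.im) : ℂ) = S at *
    have k₁ : (-1 + I * A * S) * (A + B * C + I * S) = (B + A * C) * (-C + I * S * B) := by
      linear_combination I * S * e₁ + A * e₂ + A * S ^ 2 * I_sq
    have k₂ : (-1 + I * A * S) * (-C + I * S * B) = (A - B * C - I * S) * (B + A * C) := by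
      linear_combination -C * e₁ + A * B * e₂ + A * B * S ^ 2 * I_sq
    have hk : (-1 + I * A * S) ^ 2 * (A + B * C + I * S) =
        (A - B * C - I * S) * (B + A * C) ^ 2 := by
      linear_combination (-1 + I * A * S) * k₁ + (B + A * C) * k₂
    field_simp
    linear_combination 4 * I * (A ^ 2 - 1) * hk +
      4 * (I * A + S - I * C * B) * (B + A * C) ^ 2 * e₁ -
      4 * (A ^ 2 - 1) * S * (B + A * C) ^ 2 * I_sq
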